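/- arXiv:2301.13051 — 2 statements merged into one kernel-verified Lean document; each statement's English description precedes it below -/
import Mathlib

section
/- For the derivative of the interpolating pressure A_L(t) on the Nishimori line, Gaussian integration by parts yields d/dt (1/L^d) A_L(t) = (1/(2L^d)) E[ Σ_{i,j∈Λ} x^{(γ)}_{ij}(1 + ⟨σ_i σ_j⟩) − Σ_p Σ_{i,j∈B_p} x_{ij}(1 + ⟨σ_i σ_j⟩) ]. -/
open MeasureTheory ProbabilityTheory

/-- The Ising spin value of a configuration at a site. -/
noncomputable def spin {N : ℕ} (σ : Fin N → Bool) (i : Fin N) : ℝ :=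
  if σ i then 1 else -1

/-- The interpolating Hamiltonian (exponent) on the Nishimori line between the Kac-potential
system (couplings `xg i j = β² K(r_ij,γ)/2`, with the deterministic Nishimori mean terms) and
the collection of independent SK blocks (block assignment `blk`, couplings `xb = β²/(2 l^d)`). -/
noncomputable def nishimoriInterpH {N M : ℕ} (xg : Fin N → Fin N → ℝ) (xb : ℝ)
    (blk : Fin N → Fin M) (t : ℝ)
    (J : (Fin N × Fin N → ℝ) × (Fin N × Fin N → ℝ)) (σ : Fin N → Bool) : ℝ :=
  ∑ p : Fin N × Fin N,
    ((Real.sqrt (t * xg p.1 p.2) * J.1 p + t * xg p.1 p.2)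
      + (if blk p.1 = blk p.2 then
          Real.sqrt ((1 - t) * xb) * J.2 p + (1 - t) * xb else 0))
      * spin σ p.1 * spin σ p.2

/-- The Gibbs average `⟨σ_i σ_j⟩` of the interpolating system at parameter `t` and fixed
disorder `J`. -/
noncomputable def nishimoriInterpGibbs {N M : ℕ} (xg : Fin N → Fin N → ℝ) (xb : ℝ)
    (blk : Fin N → Fin M) (t : ℝ)
    (J : (Fin N × Fin N → ℝ) × (Fin N × Fin N → ℝ)) (i j : Fin N) : ℝ :=
  (∑ σ : Fin N → Bool, spin σ i * spin σ j *
      Real.exp (nishimoriInterpH xg xb blk t J σ)) /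
  (∑ σ : Fin N → Bool, Real.exp (nishimoriInterpH xg xb blk t J σ))

/-- The disorder measure: two independent families of i.i.d. standard Gaussians. -/
noncomputable def disorderMeasure (N : ℕ) :
    Measure ((Fin N × Fin N → ℝ) × (Fin N × Fin N → ℝ)) :=
  (Measure.pi fun _ : Fin N × Fin N => gaussianReal 0 1).prod
    (Measure.pi fun _ : Fin N × Fin N => gaussianReal 0 1)

namespace NishAux

/-- 1-dimensional Gaussian shift. -/
lemma gauss_shift_set (a : ℝ) (s : Set ℝ) :
    gaussianReal a 1 s
      = ENNReal.ofReal (∫ x in s, Real.exp (a * x - a ^ 2 / 2) ∂(gaussianReal 0 1)) := by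
  rw [gaussianReal_apply_eq_integral _ one_ne_zero]
  congr 1
  rw [gaussianReal_of_var_ne_zero _ one_ne_zero,
    setIntegral_withDensity_eq_setIntegral_toReal_smul' s (measurable_gaussianPDF _ _)
      (ae_of_all _ fun _ => gaussianPDF_lt_top)]
  congr 1
  ext x
  rw [toReal_gaussianPDF, gaussianPDFReal_def, gaussianPDFReal_def]
  simp only [smul_eq_mul]
  rw [mul_assoc ((√(2 * Real.pi * ((1 : NNReal) : ℝ)))⁻¹), ← Real.exp_add]
  congr 2
  simp only [NNReal.coe_one]
  ring

lemma integrable_shift_density (a : ℝ) :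
    Integrable (fun x => Real.exp (a * x - a ^ 2 / 2)) (gaussianReal 0 1) := by
  have := (integrable_exp_mul_gaussianReal (μ := 0) (v := 1) a).mul_const (Real.exp (-(a ^ 2 / 2)))
  refine this.congr (ae_of_all _ fun x => ?_)
  simp only [← Real.exp_add]
  ring_nf

lemma integrable_id_gauss : Integrable (fun x : ℝ => x) (gaussianReal 0 1) :=
  (memLp_id_gaussianReal (μ := 0) (v := 1) 1).integrable (by simp)

set_option linter.unusedSectionVars false

variable {ι : Type*} [Fintype ι]

/-- standard Gaussian on `ι → ℝ` -/
noncomputable abbrev gam (ι : Type*) [Fintype ι] : Measure (ι → ℝ) :=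
  Measure.pi fun _ : ι => gaussianReal 0 1

lemma gam_shift (a : ι → ℝ) :
    (gam ι).map (fun J i => J i + a i)
      = (gam ι).withDensity
          (fun J => ENNReal.ofReal (∏ i, Real.exp (a i * J i - a i ^ 2 / 2))) := by
  have h1 : (gam ι).map (fun J i => J i + a i) = Measure.pi fun i => gaussianReal (a i) 1 := by
    have : ∀ i, (gaussianReal 0 1).map (· + a i) = gaussianReal (a i) 1 := fun i => by
      rw [gaussianReal_map_add_const, zero_add]
    have hs : ∀ i, SigmaFinite ((gaussianReal 0 1).map (· + a i)) := fun i => by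
      rw [this]; infer_instance
    rw [gam, Measure.pi_map_pi (f := fun i x => x + a i) (fun i => by fun_prop)]
    simp_rw [this]
  rw [h1]
  refine Measure.pi_eq fun s hs => ?_
  rw [withDensity_apply _ (MeasurableSet.univ_pi hs), gam, Measure.restrict_pi_pi,
    ← ofReal_integral_eq_lintegral_ofReal]
  · rw [integral_fintype_prod_eq_prod (fun i x => Real.exp (a i * x - a i ^ 2 / 2)),
      ENNReal.ofReal_prod_of_nonneg (fun i _ => integral_nonneg fun x => (Real.exp_pos _).le)]
    simp_rw [gauss_shift_set]
  · exact Integrable.fintype_prod_dep fun i => (integrable_shift_density (a i)).restrict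
  · exact ae_of_all _ fun J => Finset.prod_nonneg fun i _ => (Real.exp_pos _).le

lemma gam_shift_integral (a : ι → ℝ) (f : (ι → ℝ) → ℝ) (hf : Measurable f) :
    ∫ J, f (fun i => J i + a i) ∂(gam ι)
      = ∫ J, (∏ i, Real.exp (a i * J i - a i ^ 2 / 2)) * f J ∂(gam ι) := by
  have := integral_map (μ := gam ι) (φ := fun J i => J i + a i) (f := f)
    (Measurable.aemeasurable (by fun_prop)) hf.aestronglyMeasurable
  rw [← this, gam_shift, integral_withDensity_eq_integral_toReal_smul (by fun_prop)
    (ae_of_all _ fun _ => ENNReal.ofReal_lt_top)]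
  congr 1
  ext J
  rw [ENNReal.toReal_ofReal (Finset.prod_nonneg fun i _ => (Real.exp_pos _).le), smul_eq_mul]

lemma gam_gauge (e : ι → ℝ) (he : ∀ i, e i ^ 2 = 1) :
    MeasurePreserving (fun (J : ι → ℝ) i => e i * J i) (gam ι) (gam ι) := by
  refine measurePreserving_pi _ _ fun i => ⟨by fun_prop, ?_⟩
  rw [gaussianReal_map_const_mul]
  congr 1
  · simp
  · ext; simp [he]

lemma integrable_coord (i : ι) : Integrable (fun J : ι → ℝ => J i) (gam ι) :=
  integrable_comp_eval (μ := fun _ : ι => gaussianReal 0 1) (f := fun x : ℝ => x)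
    integrable_id_gauss

variable [DecidableEq ι]

lemma gam_update (i : ι) :
    MeasurePreserving (fun q : (ι → ℝ) × ℝ => Function.update q.1 i q.2)
      ((gam ι).prod (gaussianReal 0 1)) (gam ι) := by
  have hm : Measurable (fun q : (ι → ℝ) × ℝ => Function.update q.1 i q.2) := by
    refine measurable_pi_lambda _ fun j => ?_
    by_cases h : j = i
    · subst h; simpa using measurable_snd
    · simp only [Function.update_of_ne h]; fun_prop
  refine ⟨hm, (Measure.pi_eq fun s hs => ?_).symm⟩
  rw [Measure.map_apply hm (MeasurableSet.univ_pi hs)]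
  have : (fun q : (ι → ℝ) × ℝ => Function.update q.1 i q.2) ⁻¹' (Set.univ.pi s)
      = (Set.univ.pi (Function.update s i Set.univ)) ×ˢ (s i) := by
    ext q
    simp only [Set.mem_preimage, Set.mem_pi, Set.mem_univ, true_imp_iff, Set.mem_prod]
    constructor
    · intro h
      refine ⟨fun j => ?_, by simpa using h i⟩
      by_cases hj : j = i
      · subst hj; simp
      · simpa [hj] using h j
    · rintro ⟨h, h'⟩ j
      by_cases hj : j = i
      · subst hj; simpa using h'
      · simpa [hj] using h j
  rw [this, Measure.prod_prod, Measure.pi_pi, ← Finset.prod_erase_mul _ _ (Finset.mem_univ i),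
    ← Finset.prod_erase_mul _ (fun j => gaussianReal 0 1 (s j)) (Finset.mem_univ i)]
  simp only [Function.update_self, measure_univ, mul_one]
  congr 1
  refine Finset.prod_congr rfl fun j hj => ?_
  rw [Function.update_of_ne (Finset.ne_of_mem_erase hj)]

/-- Stein lemma in dimension one for bounded functions. -/
lemma stein_one (f f' : ℝ → ℝ) (C : ℝ) (hd : ∀ x, HasDerivAt f (f' x) x)
    (hf : ∀ x, |f x| ≤ C) (hf' : ∀ x, |f' x| ≤ C) (hm' : Measurable f') :
    ∫ x, x * f x ∂(gaussianReal 0 1) = ∫ x, f' x ∂(gaussianReal 0 1) := by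
  have hm : Measurable f :=
    (continuous_iff_continuousAt.2 fun x => (hd x).continuousAt).measurable
  have hp : ∀ x, HasDerivAt (gaussianPDFReal 0 1) (- x * gaussianPDFReal 0 1 x) x := by
    intro x
    rw [gaussianPDFReal_def]
    have h : HasDerivAt (fun x : ℝ => -(x - 0) ^ 2 / (2 * ((1 : NNReal) : ℝ))) (-x) x := by
      have := ((((hasDerivAt_id x).sub_const 0).pow 2).neg).div_const (2 * ((1 : NNReal) : ℝ))
      convert! this using 1
      simp
      ring
    convert! (h.exp).const_mul ((Real.sqrt (2 * Real.pi * ((1 : NNReal) : ℝ)))⁻¹) using 1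
    ring
  have hi : Integrable (fun x => x * gaussianPDFReal 0 1 x) := by
    have := integrable_id_gauss
    rw [gaussianReal_of_var_ne_zero _ one_ne_zero,
      integrable_withDensity_iff_integrable_smul' (measurable_gaussianPDF _ _)
        (ae_of_all _ fun _ => gaussianPDF_lt_top)] at this
    refine this.congr (ae_of_all _ fun x => ?_)
    simp [toReal_gaussianPDF, mul_comm]
  have key := integral_mul_deriv_eq_deriv_mul_of_integrable (u := f) (u' := f')
    (v := gaussianPDFReal 0 1) (v' := fun x => - x * gaussianPDFReal 0 1 x)
    (fun x _ => hd x) (fun x _ => hp x)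
    (by
      refine (hi.neg).bdd_mul (c := C) hm.aestronglyMeasurable (ae_of_all _ hf) |>.congr
        (ae_of_all _ fun x => ?_)
      simp)
    ((integrable_gaussianPDFReal 0 1).bdd_mul (c := C) hm'.aestronglyMeasurable (ae_of_all _ hf'))
    ((integrable_gaussianPDFReal 0 1).bdd_mul (c := C) hm.aestronglyMeasurable (ae_of_all _ hf))
  rw [integral_gaussianReal_eq_integral_smul one_ne_zero,
    integral_gaussianReal_eq_integral_smul one_ne_zero]
  have e1 : ∫ x, gaussianPDFReal 0 1 x • (x * f x)
      = - ∫ x, f x * (- x * gaussianPDFReal 0 1 x) := by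
    rw [← integral_neg]; congr 1; ext x; simp only [smul_eq_mul]; ring
  rw [e1, key, neg_neg]
  congr 1; ext x; simp only [smul_eq_mul]; ring

/-- Stein lemma (Gaussian integration by parts) for a coordinate. -/
lemma stein (i : ι) (f f' : (ι → ℝ) → ℝ) (C : ℝ)
    (hd : ∀ (J : ι → ℝ) (x : ℝ), HasDerivAt (fun y => f (Function.update J i y))
      (f' (Function.update J i x)) x)
    (hf : ∀ x, |f x| ≤ C) (hf' : ∀ x, |f' x| ≤ C) (hm : Measurable f) (hm' : Measurable f') :
    ∫ J, J i * f J ∂(gam ι) = ∫ J, f' J ∂(gam ι) := by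
  have mp := gam_update (ι := ι) i
  have h1 : Integrable (fun J : ι → ℝ => J i * f J) (gam ι) := by
    have := (integrable_coord i).bdd_mul (c := C) hm.aestronglyMeasurable (ae_of_all _ hf)
    exact this.congr (ae_of_all _ fun x => mul_comm _ _)
  have h2 : Integrable f' (gam ι) :=
    Integrable.of_bound hm'.aestronglyMeasurable C (ae_of_all _ hf')
  have i1 := (mp.integrable_comp h1.aestronglyMeasurable).2 h1
  have i2 := (mp.integrable_comp h2.aestronglyMeasurable).2 h2
  have e1 := integral_map mp.measurable.aemeasurable
    (f := fun J : ι → ℝ => J i * f J) (by rw [mp.map_eq]; exact h1.aestronglyMeasurable)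
  have e2 := integral_map mp.measurable.aemeasurable
    (f := f') (by rw [mp.map_eq]; exact h2.aestronglyMeasurable)
  rw [mp.map_eq] at e1 e2
  rw [e1, e2]
  refine (integral_prod _ i1).trans (Eq.trans ?_ (integral_prod _ i2).symm)
  congr 1
  ext J
  simp only [Function.comp_apply, Function.update_self]
  exact stein_one _ _ C (fun x => hd J x) (fun x => hf _) (fun x => hf' _)
    (hm'.comp (measurable_update J))


section model

variable {ι : Type*} [Fintype ι] {S : Type*} [Fintype S]

noncomputable def En (s : ι → S → ℝ) (h : ι → ℝ) (σ : S) : ℝ := ∑ i, h i * s i σ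

noncomputable def Zf (s : ι → S → ℝ) (h : ι → ℝ) : ℝ := ∑ σ, Real.exp (En s h σ)

noncomputable def Nf (s : ι → S → ℝ) (k : ι) (h : ι → ℝ) : ℝ := ∑ σ, s k σ * Real.exp (En s h σ)

noncomputable def Gf (s : ι → S → ℝ) (k : ι) (h : ι → ℝ) : ℝ := Nf s k h / Zf s h

lemma Zf_pos [Nonempty S] (s : ι → S → ℝ) (h : ι → ℝ) : 0 < Zf s h :=
  Finset.sum_pos (fun _ _ => Real.exp_pos _) Finset.univ_nonempty

lemma abs_s_le {s : ι → S → ℝ} (hs : ∀ i σ, s i σ ^ 2 = 1) (i : ι) (σ : S) : |s i σ| = 1 := by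
  rw [← Real.sqrt_sq_eq_abs, hs, Real.sqrt_one]

lemma Gf_abs_le [Nonempty S] {s : ι → S → ℝ} (hs : ∀ i σ, s i σ ^ 2 = 1) (k : ι) (h : ι → ℝ) :
    |Gf s k h| ≤ 1 := by
  rw [Gf, abs_div, abs_of_pos (Zf_pos s h), div_le_one (Zf_pos s h)]
  refine (Finset.abs_sum_le_sum_abs _ _).trans (Finset.sum_le_sum fun σ _ => ?_)
  rw [abs_mul, abs_s_le hs, one_mul, abs_of_pos (Real.exp_pos _)]

@[fun_prop]
lemma measurable_En (s : ι → S → ℝ) (σ : S) : Measurable (fun h => En s h σ) := by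
  unfold En; fun_prop

@[fun_prop]
lemma measurable_Zf (s : ι → S → ℝ) : Measurable (Zf s) := by
  unfold Zf; fun_prop

@[fun_prop]
lemma measurable_Nf (s : ι → S → ℝ) (k : ι) : Measurable (Nf s k) := by
  unfold Nf; fun_prop

@[fun_prop]
lemma measurable_Gf (s : ι → S → ℝ) (k : ι) : Measurable (Gf s k) := by
  unfold Gf; fun_prop

lemma hasDerivAt_En (s : ι → S → ℝ) (h : ℝ → ι → ℝ) (h' : ι → ℝ) (x : ℝ)
    (hh : ∀ i, HasDerivAt (fun y => h y i) (h' i) x) (σ : S) :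
    HasDerivAt (fun y => En s (h y) σ) (∑ i, h' i * s i σ) x := by
  unfold En
  exact HasDerivAt.fun_sum fun i _ => (hh i).mul_const _

lemma hasDerivAt_Zf (s : ι → S → ℝ) (h : ℝ → ι → ℝ) (h' : ι → ℝ) (x : ℝ)
    (hh : ∀ i, HasDerivAt (fun y => h y i) (h' i) x) :
    HasDerivAt (fun y => Zf s (h y)) (∑ i, h' i * Nf s i (h x)) x := by
  have : HasDerivAt (fun y => Zf s (h y))
      (∑ σ, Real.exp (En s (h x) σ) * (∑ i, h' i * s i σ)) x := by
    unfold Zf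
    exact HasDerivAt.fun_sum fun σ _ => (hasDerivAt_En s h h' x hh σ).exp
  convert! this using 1
  simp_rw [Nf, Finset.mul_sum]
  rw [Finset.sum_comm]
  refine Finset.sum_congr rfl fun σ _ => Finset.sum_congr rfl fun i _ => by ring

lemma hasDerivAt_logZf [Nonempty S] (s : ι → S → ℝ) (h : ℝ → ι → ℝ) (h' : ι → ℝ) (x : ℝ)
    (hh : ∀ i, HasDerivAt (fun y => h y i) (h' i) x) :
    HasDerivAt (fun y => Real.log (Zf s (h y))) (∑ i, h' i * Gf s i (h x)) x := by
  convert! (hasDerivAt_Zf s h h' x hh).log (Zf_pos s _).ne' using 1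
  simp_rw [Gf, Finset.sum_div, mul_div_assoc]

lemma hasDerivAt_Gf [Nonempty S] [DecidableEq ι] {s : ι → S → ℝ} (hs : ∀ i σ, s i σ ^ 2 = 1)
    (h : ℝ → ι → ℝ) (k : ι) (c : ℝ) (x : ℝ)
    (hh : ∀ i, HasDerivAt (fun y => h y i) (if i = k then c else 0) x) :
    HasDerivAt (fun y => Gf s k (h y)) (c * (1 - Gf s k (h x) ^ 2)) x := by
  have hZ := hasDerivAt_Zf s h _ x hh
  have hN : HasDerivAt (fun y => Nf s k (h y)) (c * Zf s (h x)) x := by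
    have : HasDerivAt (fun y => Nf s k (h y))
        (∑ σ, s k σ * (Real.exp (En s (h x) σ) * (∑ i, (if i = k then c else 0) * s i σ))) x := by
      unfold Nf
      exact HasDerivAt.fun_sum fun σ _ => ((hasDerivAt_En s h _ x hh σ).exp).const_mul _
    convert! this using 1
    rw [Zf, Finset.mul_sum]
    refine Finset.sum_congr rfl fun σ _ => ?_
    simp only [ite_mul, zero_mul, Finset.sum_ite_eq', Finset.mem_univ, if_true]
    linear_combination (-c * Real.exp (En s (h x) σ)) * hs k σ
  have hp := (Zf_pos s (h x)).ne'
  convert! hN.div hZ hp using 1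
  simp only [ite_mul, zero_mul, Finset.sum_ite_eq', Finset.mem_univ, if_true, Gf]
  field_simp

/-- the fields on the Nishimori line -/
def fld (u : ι → ℝ) (J : ι → ℝ) : ι → ℝ := fun i => u i * J i + u i ^ 2

@[fun_prop]
lemma measurable_fld (u : ι → ℝ) : Measurable (fld u) := by
  unfold fld; fun_prop

lemma integrable_Gf_pow [Nonempty S] {s : ι → S → ℝ} (hs : ∀ i σ, s i σ ^ 2 = 1) (k : ι)
    (u : ι → ℝ) (p : ℕ) : Integrable (fun J => Gf s k (fld u J) ^ p) (gam ι) := by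
  refine Integrable.of_bound (Measurable.aestronglyMeasurable (by fun_prop)) 1
    (ae_of_all _ fun J => ?_)
  rw [Real.norm_eq_abs, abs_pow]
  exact pow_le_one₀ (abs_nonneg _) (Gf_abs_le hs k _)

lemma ibp [Nonempty S] {s : ι → S → ℝ} (hs : ∀ i σ, s i σ ^ 2 = 1) (k : ι) (u : ι → ℝ) :
    ∫ J, J k * Gf s k (fld u J) ∂(gam ι)
      = u k * (1 - ∫ J, Gf s k (fld u J) ^ 2 ∂(gam ι)) := by
  classical
  have hG : ∀ h, Gf s k h ^ 2 ≤ 1 := fun h => by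
    rw [← sq_abs]; exact pow_le_one₀ (abs_nonneg _) (Gf_abs_le hs k _)
  rw [stein k (fun J => Gf s k (fld u J)) (fun J => u k * (1 - Gf s k (fld u J) ^ 2))
    (max 1 |u k|) ?_ ?_ ?_ (by fun_prop) (by fun_prop)]
  · rw [integral_const_mul, integral_sub (integrable_const _) (integrable_Gf_pow hs k u 2)]
    simp
  · intro J x
    refine hasDerivAt_Gf hs (fun y => fld u (Function.update J k y)) k (u k) x fun i => ?_
    by_cases hi : i = k
    · subst hi
      simp only [fld, Function.update_self, if_true]
      simpa using ((hasDerivAt_id x).const_mul (u i)).add_const (u i ^ 2)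
    · simp only [fld, Function.update_of_ne hi, if_neg hi]
      exact hasDerivAt_const _ _
  · exact fun J => (Gf_abs_le hs k _).trans (le_max_left _ _)
  · intro J
    rw [abs_mul]
    refine le_trans ?_ (le_max_right _ _)
    refine mul_le_of_le_one_right (abs_nonneg _) ?_
    rw [abs_le]
    constructor <;> nlinarith [hG (fld u J), sq_nonneg (Gf s k (fld u J))]

lemma Gf_gauge (s : ι → S → ℝ) (hs : ∀ i σ, s i σ ^ 2 = 1)
    (m : S → S ≃ S) (hm : ∀ i τ σ, s i (m τ σ) = s i τ * s i σ) (k : ι) (τ : S) (h : ι → ℝ) :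
    Gf s k (fun i => s i τ * h i) = s k τ * Gf s k h := by
  have hE : ∀ σ, En s (fun i => s i τ * h i) (m τ σ) = En s h σ := fun σ => by
    unfold En
    refine Finset.sum_congr rfl fun i _ => ?_
    rw [hm]
    linear_combination (h i * s i σ) * hs i τ
  have hZ : Zf s (fun i => s i τ * h i) = Zf s h := by
    unfold Zf
    rw [← (m τ).sum_comp]
    simp_rw [hE]
  have hN : Nf s k (fun i => s i τ * h i) = s k τ * Nf s k h := by
    unfold Nf
    rw [← (m τ).sum_comp]
    simp_rw [hE, hm, Finset.mul_sum, mul_assoc]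
  rw [Gf, Gf, hZ, hN, mul_div_assoc]

lemma gauge_shift [Nonempty S] (s : ι → S → ℝ) (hs : ∀ i σ, s i σ ^ 2 = 1)
    (m : S → S ≃ S) (hm : ∀ i τ σ, s i (m τ σ) = s i τ * s i σ) (k : ι) (u : ι → ℝ) (p : ℕ)
    (τ : S) :
    ∫ J, Gf s k (fld u J) ^ p ∂(gam ι) =
      ∫ J, Real.exp (-∑ i, u i ^ 2 / 2) * (s k τ ^ p * Real.exp (En s (fun i => u i * J i) τ)
        * Gf s k (fun i => u i * J i) ^ p) ∂(gam ι) := by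
  have mp := gam_gauge (fun i => s i τ) (fun i => hs i τ)
  have e1 := integral_map (μ := gam ι) mp.measurable.aemeasurable
    (f := fun J : ι → ℝ => Gf s k (fld u J) ^ p) (Measurable.aestronglyMeasurable (by fun_prop))
  rw [mp.map_eq] at e1
  rw [e1]
  have e2 : ∀ J : ι → ℝ, Gf s k (fld u (fun i => s i τ * J i)) ^ p
      = s k τ ^ p * Gf s k (fun i => u i * (J i + u i * s i τ)) ^ p := by
    intro J
    rw [← mul_pow, ← Gf_gauge s hs m hm]
    congr 2
    ext i
    simp only [fld]
    linear_combination (-(u i) ^ 2) * hs i τ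
  simp_rw [e2]
  rw [integral_const_mul, gam_shift_integral (fun i => u i * s i τ)
    (fun J => Gf s k (fun i => u i * J i) ^ p) (by fun_prop), ← integral_const_mul]
  congr 1
  ext J
  have : ∏ i, Real.exp (u i * s i τ * J i - (u i * s i τ) ^ 2 / 2)
      = Real.exp (-∑ i, u i ^ 2 / 2) * Real.exp (En s (fun i => u i * J i) τ) := by
    rw [← Real.exp_sum, ← Real.exp_add, En, ← Finset.sum_neg_distrib, ← Finset.sum_add_distrib]
    congr 1
    refine Finset.sum_congr rfl fun i _ => ?_
    linear_combination (-(u i) ^ 2 / 2) * hs i τ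
  rw [this]
  ring

lemma integrable_expEn [Nonempty S] (s : ι → S → ℝ) (u : ι → ℝ) (τ : S) :
    Integrable (fun J : ι → ℝ => Real.exp (En s (fun i => u i * J i) τ)) (gam ι) := by
  have : Integrable (fun J : ι → ℝ => ∏ i, Real.exp (u i * s i τ * J i)) (gam ι) :=
    Integrable.fintype_prod_dep (f := fun i x => Real.exp (u i * s i τ * x))
      fun i => integrable_exp_mul_gaussianReal _
  refine this.congr (ae_of_all _ fun J => ?_)
  simp only [← Real.exp_sum, En]
  congr 1
  exact Finset.sum_congr rfl fun i _ => by ring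

lemma gauge_avg [Nonempty S] (s : ι → S → ℝ) (hs : ∀ i σ, s i σ ^ 2 = 1)
    (m : S → S ≃ S) (hm : ∀ i τ σ, s i (m τ σ) = s i τ * s i σ) (k : ι) (u : ι → ℝ) (p : ℕ) :
    (Fintype.card S : ℝ) * ∫ J, Gf s k (fld u J) ^ p ∂(gam ι) =
      ∫ J, Real.exp (-∑ i, u i ^ 2 / 2) *
        ((∑ τ, s k τ ^ p * Real.exp (En s (fun i => u i * J i) τ))
        * Gf s k (fun i => u i * J i) ^ p) ∂(gam ι) := by
  have : (Fintype.card S : ℝ) * ∫ J, Gf s k (fld u J) ^ p ∂(gam ι)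
      = ∑ τ : S, ∫ J, Gf s k (fld u J) ^ p ∂(gam ι) := by simp
  rw [this, Finset.sum_congr rfl fun τ _ => gauge_shift s hs m hm k u p τ, ← integral_finsetSum]
  · congr 1
    ext J
    rw [Finset.sum_mul, Finset.mul_sum]
  · intro τ _
    refine Integrable.const_mul ?_ _
    have := ((integrable_expEn s u τ).const_mul (s k τ ^ p)).bdd_mul (c := 1)
      (f := fun J => Gf s k (fun i => u i * J i) ^ p)
      (Measurable.aestronglyMeasurable (by fun_prop))
      (ae_of_all _ fun J => by
        rw [Real.norm_eq_abs, abs_pow]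
        exact pow_le_one₀ (abs_nonneg _) (Gf_abs_le hs k _))
    exact this.congr (ae_of_all _ fun J => mul_comm _ _)

/-- The Nishimori identity. -/
lemma nishimori [Nonempty S] (s : ι → S → ℝ) (hs : ∀ i σ, s i σ ^ 2 = 1)
    (m : S → S ≃ S) (hm : ∀ i τ σ, s i (m τ σ) = s i τ * s i σ) (k : ι) (u : ι → ℝ) :
    ∫ J, Gf s k (fld u J) ^ 2 ∂(gam ι) = ∫ J, Gf s k (fld u J) ∂(gam ι) := by
  have h1 := gauge_avg s hs m hm k u 1
  have h2 := gauge_avg s hs m hm k u 2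
  have hc : (Fintype.card S : ℝ) ≠ 0 := by
    exact_mod_cast Fintype.card_ne_zero
  apply mul_left_cancel₀ hc
  simp only [pow_one] at h1
  rw [h1, h2]
  congr 1
  ext J
  have e1 : ∑ τ, s k τ ^ 2 * Real.exp (En s (fun i => u i * J i) τ)
      = Zf s (fun i => u i * J i) := by simp [hs, Zf]
  have e2 : ∑ τ, s k τ * Real.exp (En s (fun i => u i * J i) τ)
      = Zf s (fun i => u i * J i) * Gf s k (fun i => u i * J i) := by
    rw [Gf, mul_div_cancel₀ _ (Zf_pos s _).ne', Nf]
  rw [e1, e2]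
  ring

lemma integrable_logZf [Nonempty S] {s : ι → S → ℝ} (hs : ∀ i σ, s i σ ^ 2 = 1) (u : ι → ℝ) :
    Integrable (fun J => Real.log (Zf s (fld u J))) (gam ι) := by
  have hb : Integrable (fun J : ι → ℝ => |Real.log (Fintype.card S)| + ∑ i, |fld u J i|)
      (gam ι) := by
    refine (integrable_const _).add (integrable_finsetSum _ fun i _ => ?_)
    exact (((integrable_coord i).const_mul (u i)).add (integrable_const (u i ^ 2))).abs
  refine hb.mono' (Measurable.aestronglyMeasurable (by fun_prop)) (ae_of_all _ fun J => ?_)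
  set h := fld u J
  have hE : ∀ σ, |En s h σ| ≤ ∑ i, |h i| := fun σ => by
    refine (Finset.abs_sum_le_sum_abs _ _).trans (Finset.sum_le_sum fun i _ => ?_)
    rw [abs_mul, abs_s_le hs, mul_one]
  have hZ := Zf_pos s h
  have hc : (0 : ℝ) < Fintype.card S := by exact_mod_cast Fintype.card_pos
  have up : Real.log (Zf s h) ≤ Real.log (Fintype.card S) + ∑ i, |h i| := by
    rw [Real.log_le_iff_le_exp hZ, Real.exp_add, Real.exp_log hc]
    refine (Finset.sum_le_sum (g := fun _ => Real.exp (∑ i, |h i|)) fun σ _ =>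
      Real.exp_le_exp.2 ((le_abs_self _).trans (hE σ))).trans ?_
    simp
  have lo : -∑ i, |h i| ≤ Real.log (Zf s h) := by
    rw [Real.le_log_iff_exp_le hZ]
    obtain ⟨σ⟩ := ‹Nonempty S›
    refine (Real.exp_le_exp.2 (neg_le_of_abs_le (hE σ))).trans ?_
    exact Finset.single_le_sum (f := fun σ => Real.exp (En s h σ))
      (fun _ _ => (Real.exp_pos _).le) (Finset.mem_univ σ)
  rw [Real.norm_eq_abs, abs_le]
  constructor
  · linarith [abs_nonneg (Real.log (Fintype.card S : ℝ))]
  · linarith [le_abs_self (Real.log (Fintype.card S : ℝ))]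

theorem main_deriv [Nonempty S] (s : ι → S → ℝ) (hs : ∀ i σ, s i σ ^ 2 = 1)
    (m : S → S ≃ S) (hm : ∀ i τ σ, s i (m τ σ) = s i τ * s i σ)
    (u u' : ℝ → ι → ℝ) (t B : ℝ) (U : Set ℝ) (hU : U ∈ nhds t)
    (hd : ∀ x ∈ U, ∀ i, HasDerivAt (fun y => u y i) (u' x i) x)
    (hB : ∀ x ∈ U, ∀ i, |u x i| ≤ B) (hB' : ∀ x ∈ U, ∀ i, |u' x i| ≤ B) :
    HasDerivAt (fun x => ∫ J, Real.log (Zf s (fld (u x) J)) ∂(gam ι))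
      (∑ i, u t i * u' t i * (1 + ∫ J, Gf s i (fld (u t) J) ∂(gam ι))) t := by
  have key := hasDerivAt_integral_of_dominated_loc_of_deriv_le (μ := gam ι)
    (F := fun x J => Real.log (Zf s (fld (u x) J))) (x₀ := t) (s := U)
    (F' := fun x J => ∑ i, (u' x i * J i + 2 * u x i * u' x i) * Gf s i (fld (u x) J))
    (bound := fun J => ∑ i, (B * |J i| + 2 * B * B)) hU
    (Filter.Eventually.of_forall fun x => Measurable.aestronglyMeasurable (by fun_prop))
    (integrable_logZf hs (u t)) (Measurable.aestronglyMeasurable (by fun_prop))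
    (ae_of_all _ fun J x hx => ?_) ?_ (ae_of_all _ fun J x hx => ?_)
  · convert! key.2 using 1
    have i1 : ∀ i, Integrable (fun J : ι → ℝ => J i * Gf s i (fld (u t) J)) (gam ι) := fun i => by
      have := (integrable_coord i).bdd_mul (c := 1) (f := fun J => Gf s i (fld (u t) J))
        (Measurable.aestronglyMeasurable (by fun_prop)) (ae_of_all _ fun J => Gf_abs_le hs i _)
      exact this.congr (ae_of_all _ fun J => mul_comm _ _)
    have i2 : ∀ i, Integrable (fun J : ι → ℝ => Gf s i (fld (u t) J)) (gam ι) := fun i => by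
      simpa using integrable_Gf_pow hs i (u t) 1
    have e : ∀ i (J : ι → ℝ), (u' t i * J i + 2 * u t i * u' t i) * Gf s i (fld (u t) J)
        = u' t i * (J i * Gf s i (fld (u t) J))
          + 2 * u t i * u' t i * Gf s i (fld (u t) J) := fun i J => by ring
    simp_rw [e]
    have i3 : ∀ i ∈ Finset.univ, Integrable (fun J : ι → ℝ => u' t i * (J i * Gf s i (fld (u t) J))
          + 2 * u t i * u' t i * Gf s i (fld (u t) J)) (gam ι) :=
      fun i _ => ((i1 i).const_mul _).add ((i2 i).const_mul _)
    rw [integral_finsetSum _ i3]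
    refine Finset.sum_congr rfl fun i _ => ?_
    rw [integral_add ((i1 i).const_mul _) ((i2 i).const_mul _), integral_const_mul,
      integral_const_mul, ibp hs, nishimori s hs m hm]
    ring
  · refine (Finset.abs_sum_le_sum_abs _ _).trans (Finset.sum_le_sum fun i _ => ?_)
    have b1 := hB x hx i
    have b2 := hB' x hx i
    have hB0 : 0 ≤ B := (abs_nonneg _).trans b1
    rw [abs_mul]
    refine (mul_le_of_le_one_right (abs_nonneg _) (Gf_abs_le hs i _)).trans ?_
    refine (abs_add_le _ _).trans (add_le_add ?_ ?_)
    · rw [abs_mul]; gcongr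
    · rw [abs_mul, abs_mul, abs_two]; gcongr
  · refine integrable_finsetSum _ fun i _ => ?_
    exact ((integrable_coord i).abs.const_mul B).add (integrable_const _)
  · refine hasDerivAt_logZf s (fun x => fld (u x) J) _ x fun i => ?_
    have := ((hd x hx i).mul_const (J i)).add ((hd x hx i).pow 2)
    convert! this using 1
    simp

theorem main_deriv' [Nonempty S] (s : ι → S → ℝ) (hs : ∀ i σ, s i σ ^ 2 = 1)
    (m : S → S ≃ S) (hm : ∀ i τ σ, s i (m τ σ) = s i τ * s i σ)
    (u u' : ℝ → ι → ℝ) (t : ℝ)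
    (hd : ∀ᶠ x in nhds t, ∀ i, HasDerivAt (fun y => u y i) (u' x i) x)
    (hc : ∀ i, ContinuousAt (fun x => u' x i) t) :
    HasDerivAt (fun x => ∫ J, Real.log (Zf s (fld (u x) J)) ∂(gam ι))
      (∑ i, u t i * u' t i * (1 + ∫ J, Gf s i (fld (u t) J) ∂(gam ι))) t := by
  set B : ℝ := ∑ i, (|u t i| + |u' t i|) + 1 with hBdef
  have hle : ∀ i, |u t i| + |u' t i| ≤ ∑ i, (|u t i| + |u' t i|) := fun i =>
    Finset.single_le_sum (f := fun i => |u t i| + |u' t i|) (fun _ _ => by positivity)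
      (Finset.mem_univ i)
  have h1 : ∀ᶠ x in nhds t, ∀ i, |u x i| < B := Filter.eventually_all.2 fun i =>
    (((hd.self_of_nhds) i).continuousAt.abs).eventually_lt_const
      (by linarith [hle i, abs_nonneg (u' t i)])
  have h2 : ∀ᶠ x in nhds t, ∀ i, |u' x i| < B := Filter.eventually_all.2 fun i =>
    ((hc i).abs).eventually_lt_const (by linarith [hle i, abs_nonneg (u t i)])
  exact main_deriv s hs m hm u u' t B _ (hd.and (h1.and h2)) (fun x hx => hx.1)
    (fun x hx i => (hx.2.1 i).le) (fun x hx i => (hx.2.2 i).le)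

end model


section special

variable {N M : ℕ}

/-- pair spins indexed by two copies of the set of ordered pairs -/
noncomputable def sp (N : ℕ) : (Fin N × Fin N) ⊕ (Fin N × Fin N) → (Fin N → Bool) → ℝ :=
  fun i σ => Sum.elim (fun p => spin σ p.1 * spin σ p.2) (fun p => spin σ p.1 * spin σ p.2) i

lemma spin_sq (σ : Fin N → Bool) (i : Fin N) : spin σ i ^ 2 = 1 := by
  unfold spin; split_ifs <;> norm_num

lemma sp_sq (i) (σ : Fin N → Bool) : sp N i σ ^ 2 = 1 := by
  rcases i with p | p <;> simp [sp, mul_pow, spin_sq]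

/-- gauge action -/
def gact (τ : Fin N → Bool) : (Fin N → Bool) ≃ (Fin N → Bool) where
  toFun σ := fun i => τ i == σ i
  invFun σ := fun i => τ i == σ i
  left_inv σ := by ext i; cases h : τ i <;> cases h' : σ i <;> simp [h, h']
  right_inv σ := by ext i; cases h : τ i <;> cases h' : σ i <;> simp [h, h']

lemma spin_gact (τ σ : Fin N → Bool) (i : Fin N) :
    spin (gact τ σ) i = spin τ i * spin σ i := by
  unfold spin gact
  cases h : τ i <;> cases h' : σ i <;> simp [h, h']

lemma sp_gact (i) (τ σ : Fin N → Bool) : sp N i (gact τ σ) = sp N i τ * sp N i σ := by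
  rcases i with p | p <;> simp only [sp, Sum.elim_inl, Sum.elim_inr, spin_gact] <;> ring

noncomputable def uu (xg : Fin N → Fin N → ℝ) (xb : ℝ) (blk : Fin N → Fin M) (x : ℝ) :
    (Fin N × Fin N) ⊕ (Fin N × Fin N) → ℝ :=
  Sum.elim (fun p => Real.sqrt x * Real.sqrt (xg p.1 p.2))
    (fun p => Real.sqrt (1 - x) * (if blk p.1 = blk p.2 then Real.sqrt xb else 0))

noncomputable def uu' (xg : Fin N → Fin N → ℝ) (xb : ℝ) (blk : Fin N → Fin M) (x : ℝ) :
    (Fin N × Fin N) ⊕ (Fin N × Fin N) → ℝ :=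
  Sum.elim (fun p => 1 / (2 * Real.sqrt x) * Real.sqrt (xg p.1 p.2))
    (fun p => -1 / (2 * Real.sqrt (1 - x)) * (if blk p.1 = blk p.2 then Real.sqrt xb else 0))

lemma interpH_eq (xg : Fin N → Fin N → ℝ) (xb : ℝ) (hxg : ∀ i j, 0 ≤ xg i j) (hxb : 0 ≤ xb)
    (blk : Fin N → Fin M) (x : ℝ) (hx : x ∈ Set.Ioo (0 : ℝ) 1)
    (J : (Fin N × Fin N → ℝ) × (Fin N × Fin N → ℝ)) (σ : Fin N → Bool) :
    nishimoriInterpH xg xb blk x J σ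
      = En (sp N) (fld (uu xg xb blk x) (Sum.elim J.1 J.2)) σ := by
  have hx0 : 0 ≤ x := hx.1.le
  have hx1 : 0 ≤ 1 - x := by linarith [hx.2]
  rw [nishimoriInterpH, En, Fintype.sum_sum_type, ← Finset.sum_add_distrib]
  refine Finset.sum_congr rfl fun p _ => ?_
  simp only [fld, uu, sp, Sum.elim_inl, Sum.elim_inr, mul_pow, Real.sq_sqrt hx0, Real.sq_sqrt hx1,
    Real.sq_sqrt (hxg _ _), Real.sqrt_mul hx0, Real.sqrt_mul hx1]
  split_ifs
  · rw [Real.sq_sqrt hxb]; ring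
  · ring

lemma gibbs_eq (xg : Fin N → Fin N → ℝ) (xb : ℝ) (hxg : ∀ i j, 0 ≤ xg i j) (hxb : 0 ≤ xb)
    (blk : Fin N → Fin M) (x : ℝ) (hx : x ∈ Set.Ioo (0 : ℝ) 1)
    (J : (Fin N × Fin N → ℝ) × (Fin N × Fin N → ℝ)) (p : Fin N × Fin N) :
    nishimoriInterpGibbs xg xb blk x J p.1 p.2
      = Gf (sp N) (Sum.inl p) (fld (uu xg xb blk x) (Sum.elim J.1 J.2)) := by
  simp only [nishimoriInterpGibbs, Gf, Nf, Zf, interpH_eq xg xb hxg hxb blk x hx]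
  rfl

lemma disorder_integral (f : ((Fin N × Fin N) ⊕ (Fin N × Fin N) → ℝ) → ℝ) :
    ∫ J, f (Sum.elim J.1 J.2) ∂(disorderMeasure N)
      = ∫ J, f J ∂(gam ((Fin N × Fin N) ⊕ (Fin N × Fin N))) := by
  have mp := measurePreserving_sumPiEquivProdPi_symm
    (fun _ : (Fin N × Fin N) ⊕ (Fin N × Fin N) => gaussianReal 0 1)
  rw [← mp.integral_comp']
  rfl

theorem special_deriv (xg : Fin N → Fin N → ℝ) (xb : ℝ) (hxg : ∀ i j, 0 ≤ xg i j) (hxb : 0 ≤ xb)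
    (blk : Fin N → Fin M) (t : ℝ) (ht : t ∈ Set.Ioo (0 : ℝ) 1) :
    HasDerivAt (fun x => ∫ J, Real.log (∑ σ : Fin N → Bool,
        Real.exp (nishimoriInterpH xg xb blk x J σ)) ∂(disorderMeasure N))
      ((1 / 2) * ∫ J, ((∑ p : Fin N × Fin N, xg p.1 p.2 *
            (1 + nishimoriInterpGibbs xg xb blk t J p.1 p.2))
          - ∑ p ∈ Finset.univ.filter (fun p : Fin N × Fin N => blk p.1 = blk p.2),
              xb * (1 + nishimoriInterpGibbs xg xb blk t J p.1 p.2)) ∂(disorderMeasure N)) t := by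
  have hnh : Set.Ioo (0 : ℝ) 1 ∈ nhds t := Ioo_mem_nhds ht.1 ht.2
  have main := main_deriv' (sp N) sp_sq gact sp_gact (uu xg xb blk) (uu' xg xb blk) t
    (by
      filter_upwards [hnh] with x hx i
      have hx1 : 0 < 1 - x := by linarith [hx.2]
      rcases i with p | p
      · exact (Real.hasDerivAt_sqrt hx.1.ne').mul_const _
      · exact (((hasDerivAt_id x).const_sub 1).sqrt hx1.ne').mul_const _)
    (by
      have h0 : (2 * Real.sqrt t) ≠ 0 := by have := Real.sqrt_pos.2 ht.1; positivity
      have h1 : (2 * Real.sqrt (1 - t)) ≠ 0 := by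
        have := Real.sqrt_pos.2 (sub_pos.2 ht.2); positivity
      intro i
      rcases i with p | p
      · simp only [uu', Sum.elim_inl]
        exact (ContinuousAt.div (f := fun _ : ℝ => (1 : ℝ)) (g := fun x : ℝ => 2 * Real.sqrt x) (a := t)
          continuousAt_const (by fun_prop) h0).mul continuousAt_const
      · simp only [uu', Sum.elim_inr]
        exact (ContinuousAt.div (f := fun _ : ℝ => (-1 : ℝ)) (g := fun x : ℝ => 2 * Real.sqrt (1 - x))
          (a := t) continuousAt_const (by fun_prop) h1).mul continuousAt_const)
  have hfun : (fun x => ∫ J, Real.log (∑ σ : Fin N → Bool,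
        Real.exp (nishimoriInterpH xg xb blk x J σ)) ∂(disorderMeasure N))
      =ᶠ[nhds t] fun x => ∫ J, Real.log (Zf (sp N) (fld (uu xg xb blk x) J)) ∂(gam _) := by
    filter_upwards [hnh] with x hx
    rw [← disorder_integral]
    simp only [interpH_eq xg xb hxg hxb blk x hx, Zf]
  refine HasDerivAt.congr_of_eventuallyEq ?_ hfun
  convert! main using 1
  simp only [gibbs_eq xg xb hxg hxb blk t ht]
  rw [disorder_integral (fun J => (∑ p : Fin N × Fin N, xg p.1 p.2 *
            (1 + Gf (sp N) (Sum.inl p) (fld (uu xg xb blk t) J)))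
          - ∑ p ∈ Finset.univ.filter (fun p : Fin N × Fin N => blk p.1 = blk p.2),
              xb * (1 + Gf (sp N) (Sum.inl p) (fld (uu xg xb blk t) J)))]
  have hG : ∀ i, Integrable (fun J => Gf (sp N) i (fld (uu xg xb blk t) J)) (gam _) := fun i => by
    simpa using integrable_Gf_pow sp_sq i (uu xg xb blk t) 1
  have hG1 : ∀ (c : ℝ) i,
      Integrable (fun J => c * (1 + Gf (sp N) i (fld (uu xg xb blk t) J))) (gam _) :=
    fun c i => ((integrable_const 1).add (hG i)).const_mul c
  have hI : ∀ (c : ℝ) i, ∫ J, c * (1 + Gf (sp N) i (fld (uu xg xb blk t) J)) ∂(gam _)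
      = c * (1 + ∫ J, Gf (sp N) i (fld (uu xg xb blk t) J) ∂(gam _)) := fun c i => by
    rw [integral_const_mul, integral_add (integrable_const 1) (hG i)]
    simp
  rw [integral_sub (integrable_finsetSum _ fun p _ => hG1 _ _)
      (integrable_finsetSum _ fun p _ => hG1 _ _),
    integral_finsetSum _ (fun p _ => hG1 _ _), integral_finsetSum _ (fun p _ => hG1 _ _)]
  simp only [hI]
  rw [Finset.sum_filter, Fintype.sum_sum_type, mul_sub, sub_eq_add_neg, Finset.mul_sum,
    Finset.mul_sum, ← Finset.sum_neg_distrib]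
  have h0 : Real.sqrt t ≠ 0 := (Real.sqrt_pos.2 ht.1).ne'
  have h1 : Real.sqrt (1 - t) ≠ 0 := (Real.sqrt_pos.2 (sub_pos.2 ht.2)).ne'
  congr 1
  · refine Finset.sum_congr rfl fun p _ => ?_
    have e : uu xg xb blk t (Sum.inl p) * uu' xg xb blk t (Sum.inl p) = 1 / 2 * xg p.1 p.2 := by
      simp only [uu, uu', Sum.elim_inl]
      have := Real.mul_self_sqrt (hxg p.1 p.2)
      field_simp
      nlinarith
    rw [e, mul_assoc]
  · refine Finset.sum_congr rfl fun p _ => ?_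
    have e : uu xg xb blk t (Sum.inr p) * uu' xg xb blk t (Sum.inr p)
        = if blk p.1 = blk p.2 then -(1 / 2 * xb) else 0 := by
      simp only [uu, uu', Sum.elim_inr]
      have := Real.mul_self_sqrt hxb
      split_ifs
      · field_simp
        nlinarith
      · simp
    rw [e]
    split_ifs
    · have : ∀ J, Gf (sp N) (Sum.inr p) J = Gf (sp N) (Sum.inl p) J := fun J => rfl
      simp only [this]
      ring
    · simp

end special

end NishAux

/-- derivative of the interpolating pressure `A_L(t)` on the Nishimori line:
`d/dt (1/L^d) A_L(t) = (1/(2L^d)) E[ Σ_{i,j∈Λ} x^γ_{ij} (1 + ⟨σ_iσ_j⟩)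
  - Σ_p Σ_{i,j∈B_p} x_{ij} (1 + ⟨σ_iσ_j⟩) ]`,
where `Λ` is the cube of side `L` (here `Fin (L^d)`), `B_p` are the blocks of side `l`
(given by the assignment `blk`), `x^γ_{ij} = β² K(r_ij,γ)/2` and `x_{ij} = β²/(2 l^d)`. -/
theorem deriv_interpolating_pressure_nishimori (L d l M : ℕ) (hL : 0 < L) (hl : 0 < l)
    (β : ℝ) (Kv : Fin (L ^ d) → Fin (L ^ d) → ℝ) (hK : ∀ i j, 0 ≤ Kv i j)
    (blk : Fin (L ^ d) → Fin M) (t : ℝ) (ht : t ∈ Set.Ioo (0 : ℝ) 1) :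
    HasDerivAt (fun s => (1 / ((L : ℝ) ^ d)) * ∫ J,
        Real.log (∑ σ : Fin (L ^ d) → Bool,
          Real.exp (nishimoriInterpH (fun i j => β ^ 2 * Kv i j / 2)
            (β ^ 2 / (2 * (l : ℝ) ^ d)) blk s J σ)) ∂(disorderMeasure (L ^ d)))
      ((1 / (2 * (L : ℝ) ^ d)) * ∫ J,
        ((∑ p : Fin (L ^ d) × Fin (L ^ d), (β ^ 2 * Kv p.1 p.2 / 2) *
            (1 + nishimoriInterpGibbs (fun i j => β ^ 2 * Kv i j / 2)
              (β ^ 2 / (2 * (l : ℝ) ^ d)) blk t J p.1 p.2))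
          - ∑ p ∈ Finset.univ.filter
              (fun p : Fin (L ^ d) × Fin (L ^ d) => blk p.1 = blk p.2),
              (β ^ 2 / (2 * (l : ℝ) ^ d)) *
                (1 + nishimoriInterpGibbs (fun i j => β ^ 2 * Kv i j / 2)
                  (β ^ 2 / (2 * (l : ℝ) ^ d)) blk t J p.1 p.2))
        ∂(disorderMeasure (L ^ d))) t := by
  have h := NishAux.special_deriv (fun i j => β ^ 2 * Kv i j / 2) (β ^ 2 / (2 * (l : ℝ) ^ d))
    (fun i j => by have := hK i j; positivity) (by positivity) blk t ht
  have h2 := h.const_mul (1 / ((L : ℝ) ^ d))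
  convert! h2 using 1
  rw [← mul_assoc]
  congr 1
  rw [one_div_mul_one_div, mul_comm]
end

section
/- For the symmetric-distribution interpolation B_L(t), Gaussian integration by parts gives d/dt (1/L^d) B_L(t) = (1/(2L^d)) E[ Σ_{i,j∈Λ} x^{(γ)}_{ij}(1 − ⟨σ_i σ_j⟩²) − Σ_p Σ_{i,j∈B_p} x_{ij}(1 − ⟨σ_i σ_j⟩²) ]. -/
open MeasureTheory ProbabilityTheory

/-- The interpolating Hamiltonian (exponent) for centered (symmetric) Gaussian couplings,
between the Kac-potential system (couplings `xg i j = β² K(r_ij,γ)/2`) and the collection of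
independent SK blocks (block assignment `blk`, couplings `xb = β²/(2 l^d)`). -/
noncomputable def symInterpH {N M : ℕ} (xg : Fin N → Fin N → ℝ) (xb : ℝ)
    (blk : Fin N → Fin M) (t : ℝ)
    (J : (Fin N × Fin N → ℝ) × (Fin N × Fin N → ℝ)) (σ : Fin N → Bool) : ℝ :=
  ∑ p : Fin N × Fin N,
    (Real.sqrt (t * xg p.1 p.2) * J.1 p
      + (if blk p.1 = blk p.2 then Real.sqrt ((1 - t) * xb) * J.2 p else 0))
      * spin σ p.1 * spin σ p.2

/-- Gibbs average `⟨σ_i σ_j⟩` of the symmetric interpolating system at parameter `t` and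
fixed disorder `J`. -/
noncomputable def symInterpGibbs {N M : ℕ} (xg : Fin N → Fin N → ℝ) (xb : ℝ)
    (blk : Fin N → Fin M) (t : ℝ)
    (J : (Fin N × Fin N → ℝ) × (Fin N × Fin N → ℝ)) (i j : Fin N) : ℝ :=
  (∑ σ : Fin N → Bool, spin σ i * spin σ j * Real.exp (symInterpH xg xb blk t J σ)) /
  (∑ σ : Fin N → Bool, Real.exp (symInterpH xg xb blk t J σ))

section Helpers

set_option linter.unusedSectionVars false

/-- One-dimensional Gaussian integration by parts for bounded `C¹` functions. -/
theorem aux_stein1 (f f' : ℝ → ℝ) (C : ℝ) (hf : ∀ x, HasDerivAt f (f' x) x)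
    (hC : ∀ x, |f x| ≤ C) (hC' : ∀ x, |f' x| ≤ C) (hm : Measurable f') :
    ∫ x, x * f x ∂(gaussianReal 0 1) = ∫ x, f' x ∂(gaussianReal 0 1) := by
  have hcf : Continuous f := continuous_iff_continuousAt.2 fun x => (hf x).continuousAt
  have hphi : ∀ x, HasDerivAt (gaussianPDFReal 0 1) (-x * gaussianPDFReal 0 1 x) x := by
    intro x
    have h1 : HasDerivAt (fun x : ℝ => -(x - 0) ^ 2 / (2 * ((1 : NNReal) : ℝ))) (-x) x := by
      have := (((hasDerivAt_id x).sub_const 0).pow 2).neg.div_const (2 * ((1 : NNReal) : ℝ))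
      refine (this.congr_deriv ?_)
      simp
      ring
    have := (h1.exp).const_mul ((√(2 * Real.pi * ((1 : NNReal) : ℝ)))⁻¹)
    rw [gaussianPDFReal_def]
    refine this.congr_deriv ?_
    ring
  have hi0 : Integrable (gaussianPDFReal 0 1) := integrable_gaussianPDFReal 0 1
  have hi1 : Integrable (fun x => -x * gaussianPDFReal 0 1 x) := by
    have h := (integrable_mul_exp_neg_mul_sq (b := (1 / 2 : ℝ)) (by norm_num)).const_mul
      (-(√(2 * Real.pi * ((1 : NNReal) : ℝ)))⁻¹)
    refine h.congr (Filter.Eventually.of_forall fun x => ?_)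
    simp only [gaussianPDFReal]
    have : -(x - 0) ^ 2 / (2 * ((1 : NNReal) : ℝ)) = -(1 / 2) * x ^ 2 := by
      simp; ring
    rw [this]; ring
  have key := integral_mul_deriv_eq_deriv_mul_of_integrable (u := f) (u' := f')
    (v := gaussianPDFReal 0 1) (v' := fun x => -x * gaussianPDFReal 0 1 x)
    (fun x _ => hf x) (fun x _ => hphi x)
    (hi1.bdd_mul (c := C) hcf.aestronglyMeasurable (Filter.Eventually.of_forall hC))
    (hi0.bdd_mul (c := C) hm.aestronglyMeasurable (Filter.Eventually.of_forall hC'))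
    (hi0.bdd_mul (c := C) hcf.aestronglyMeasurable (Filter.Eventually.of_forall hC))
  rw [integral_gaussianReal_eq_integral_smul (by norm_num),
    integral_gaussianReal_eq_integral_smul (by norm_num)]
  have e1 : ∫ x, gaussianPDFReal 0 1 x • (x * f x)
      = - ∫ x, f x * (-x * gaussianPDFReal 0 1 x) := by
    rw [← integral_neg]
    congr 1; ext x; simp only [smul_eq_mul]; ring
  rw [e1, key, neg_neg]
  congr 1; ext x; simp only [smul_eq_mul]; ring

variable {ι S : Type} [Fintype ι] [DecidableEq ι] [Fintype S]

/-- Resampling one coordinate preserves a product of probability measures. -/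
theorem aux_resample (p : ι) :
    MeasurePreserving (fun z : (ι → ℝ) × ℝ => Function.update z.1 p z.2)
      ((Measure.pi fun _ : ι => gaussianReal 0 1).prod (gaussianReal 0 1))
      (Measure.pi fun _ : ι => gaussianReal 0 1) := by
  have hmeas : Measurable (fun z : (ι → ℝ) × ℝ => Function.update z.1 p z.2) := by
    rw [measurable_pi_iff]
    intro i
    by_cases h : i = p
    · subst h; simpa using measurable_snd
    · simp only [Function.update_of_ne h]
      exact (measurable_pi_apply i).comp measurable_fst
  refine ⟨hmeas, (Measure.pi_eq fun s hs => ?_).symm⟩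
  rw [Measure.map_apply hmeas (MeasurableSet.univ_pi hs)]
  have : (fun z : (ι → ℝ) × ℝ => Function.update z.1 p z.2) ⁻¹' (Set.univ.pi s)
      = (Set.univ.pi (Function.update s p Set.univ)) ×ˢ s p := by
    ext z
    simp only [Set.mem_preimage, Set.mem_pi, Set.mem_univ, forall_true_left, Set.mem_prod]
    constructor
    · intro h
      refine ⟨fun i => ?_, by simpa using h p⟩
      by_cases hi : i = p
      · subst hi; simp
      · simpa [Function.update_of_ne hi] using h i
    · rintro ⟨h, h2⟩ i
      by_cases hi : i = p
      · subst hi; simpa using h2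
      · simpa [Function.update_of_ne hi] using h i
  rw [this, Measure.prod_prod, Measure.pi_pi, ← Finset.prod_erase_mul _ _ (Finset.mem_univ p),
    ← Finset.prod_erase_mul (s := Finset.univ) (fun i => gaussianReal 0 1 (s i)) (Finset.mem_univ p)]
  simp only [Function.update_self, measure_univ, mul_one]
  congr 1
  refine Finset.prod_congr rfl fun i hi => ?_
  rw [Function.update_of_ne (Finset.ne_of_mem_erase hi)]

theorem aux_integrable_coord (p : ι) :
    Integrable (fun J : ι → ℝ => J p) (Measure.pi fun _ : ι => gaussianReal 0 1) := by
  have h : Integrable (fun x : ℝ => x) (gaussianReal 0 1) :=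
    (memLp_id_gaussianReal (μ := 0) (v := 1) 1).integrable (by simp)
  exact integrable_comp_eval (μ := fun _ : ι => gaussianReal 0 1) (i := p) h

/-- Multivariate Gaussian integration by parts in one coordinate. -/
theorem aux_stein (p : ι) (f f' : (ι → ℝ) → ℝ) (C : ℝ)
    (hf : ∀ J x, HasDerivAt (fun y => f (Function.update J p y)) (f' (Function.update J p x)) x)
    (hC : ∀ x, |f x| ≤ C) (hC' : ∀ x, |f' x| ≤ C) (hmf : Measurable f) (hm : Measurable f') :
    ∫ J, J p * f J ∂(Measure.pi fun _ : ι => gaussianReal 0 1)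
      = ∫ J, f' J ∂(Measure.pi fun _ : ι => gaussianReal 0 1) := by
  have hr := aux_resample p
  have hi : Integrable (fun J : ι → ℝ => J p * f J) (Measure.pi fun _ : ι => gaussianReal 0 1) :=
    (aux_integrable_coord p).mul_bdd (c := C) hmf.aestronglyMeasurable
      (Filter.Eventually.of_forall hC)
  have hi' : Integrable f' (Measure.pi fun _ : ι => gaussianReal 0 1) :=
    Integrable.of_bound hm.aestronglyMeasurable C (Filter.Eventually.of_forall hC')
  have e1 := integral_map (μ := ((Measure.pi fun _ : ι => gaussianReal 0 1).prod
    (gaussianReal 0 1))) hr.measurable.aemeasurable (f := fun J : ι → ℝ => J p * f J)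
    (by rw [hr.map_eq]; exact hi.aestronglyMeasurable)
  have e2 := integral_map (μ := ((Measure.pi fun _ : ι => gaussianReal 0 1).prod
    (gaussianReal 0 1))) hr.measurable.aemeasurable (f := f')
    (by rw [hr.map_eq]; exact hi'.aestronglyMeasurable)
  rw [hr.map_eq] at e1 e2
  have j1 := (hr.integrable_comp hi.aestronglyMeasurable).2 hi
  have j2 := (hr.integrable_comp hi'.aestronglyMeasurable).2 hi'
  simp only [Function.comp_def] at j1 j2
  rw [e1, e2, integral_prod _ j1, integral_prod _ j2]
  congr 1
  ext J
  simp only [Function.update_self]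
  refine aux_stein1 _ _ C (hf J) (fun x => hC _) (fun x => hC' _) ?_
  exact hm.comp (hr.measurable.comp measurable_prodMk_left)

/-- Partition function with fields `h`. -/
noncomputable def auxZ (a : ι → S → ℝ) (h : ι → ℝ) : ℝ :=
  ∑ σ, Real.exp (∑ p, h p * a p σ)

/-- Gibbs average of `a p`. -/
noncomputable def auxG (a : ι → S → ℝ) (h : ι → ℝ) (p : ι) : ℝ :=
  (∑ σ, a p σ * Real.exp (∑ p, h p * a p σ)) / auxZ a h

theorem aux_abs_one {x : ℝ} (h : x ^ 2 = 1) : |x| = 1 := by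
  rw [← abs_one, ← sq_eq_sq_iff_abs_eq_abs]; simpa using h

theorem auxZ_pos [Nonempty S] (a : ι → S → ℝ) (h : ι → ℝ) : 0 < auxZ a h :=
  Finset.sum_pos (fun _ _ => Real.exp_pos _) Finset.univ_nonempty

theorem auxG_abs [Nonempty S] (a : ι → S → ℝ) (ha : ∀ p σ, a p σ ^ 2 = 1) (h : ι → ℝ) (p : ι) :
    |auxG a h p| ≤ 1 := by
  unfold auxG
  rw [abs_div, abs_of_pos (auxZ_pos a h), div_le_one (auxZ_pos a h)]
  refine (Finset.abs_sum_le_sum_abs _ _).trans (Finset.sum_le_sum fun σ _ => ?_)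
  rw [abs_mul, aux_abs_one (ha p σ), one_mul, Real.abs_exp]

theorem auxZ_cont (a : ι → S → ℝ) : Continuous (auxZ a) := by
  unfold auxZ; fun_prop

theorem auxG_cont [Nonempty S] (a : ι → S → ℝ) (p : ι) : Continuous (fun h => auxG a h p) := by
  unfold auxG
  exact Continuous.div (by fun_prop) (auxZ_cont a) fun h => (auxZ_pos a h).ne'

theorem auxlogZ_cont [Nonempty S] (a : ι → S → ℝ) : Continuous (fun h => Real.log (auxZ a h)) :=
  (auxZ_cont a).log fun h => (auxZ_pos a h).ne'

theorem auxlogZ_bound [Nonempty S] (a : ι → S → ℝ) (ha : ∀ p σ, a p σ ^ 2 = 1) (h : ι → ℝ) :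
    |Real.log (auxZ a h)| ≤ Real.log (Fintype.card S) + ∑ p, |h p| := by
  have hE : ∀ σ, |∑ p, h p * a p σ| ≤ ∑ p, |h p| := fun σ => by
    refine (Finset.abs_sum_le_sum_abs _ _).trans (Finset.sum_le_sum fun p _ => ?_)
    rw [abs_mul, aux_abs_one (ha p σ), mul_one]
  have hcard : (1 : ℝ) ≤ Fintype.card S := by exact_mod_cast Fintype.card_pos
  have hlog := Real.log_nonneg hcard
  rw [abs_le]
  constructor
  · obtain ⟨σ⟩ := ‹Nonempty S›
    have h1 : Real.exp (∑ p, h p * a p σ) ≤ auxZ a h :=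
      Finset.single_le_sum (f := fun σ => Real.exp (∑ p, h p * a p σ))
        (fun _ _ => (Real.exp_pos _).le) (Finset.mem_univ σ)
    have h2 := Real.log_le_log (Real.exp_pos _) h1
    rw [Real.log_exp] at h2
    have := (abs_le.1 (hE σ)).1
    linarith
  · have h1 : auxZ a h ≤ Fintype.card S * Real.exp (∑ p, |h p|) := by
      unfold auxZ
      refine (Finset.sum_le_card_nsmul _ _ (Real.exp (∑ p, |h p|)) fun σ _ =>
        Real.exp_le_exp.2 ((le_abs_self _).trans (hE σ))).trans ?_
      simp
    have h2 := Real.log_le_log (auxZ_pos a h) h1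
    rwa [Real.log_mul (by positivity) (Real.exp_pos _).ne', Real.log_exp] at h2

theorem auxlogZ_deriv [Nonempty S] (a : ι → S → ℝ) (h : ℝ → ι → ℝ) (h' : ι → ℝ) (s : ℝ)
    (hd : ∀ p, HasDerivAt (fun s => h s p) (h' p) s) :
    HasDerivAt (fun s => Real.log (auxZ a (h s))) (∑ p, h' p * auxG a (h s) p) s := by
  have hE : ∀ σ, HasDerivAt (fun s => ∑ p, h s p * a p σ) (∑ p, h' p * a p σ) s := fun σ =>
    HasDerivAt.fun_sum fun p _ => (hd p).mul_const _
  have hZ : HasDerivAt (fun s => auxZ a (h s))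
      (∑ σ, Real.exp (∑ p, h s p * a p σ) * ∑ p, h' p * a p σ) s :=
    HasDerivAt.fun_sum fun σ _ => (hE σ).exp
  refine (hZ.log (auxZ_pos a (h s)).ne').congr_deriv ?_
  simp only [auxG, Finset.mul_sum, mul_div_assoc']
  rw [← Finset.sum_div, Finset.sum_comm]
  congr 1
  refine Finset.sum_congr rfl fun σ _ => Finset.sum_congr rfl fun p _ => by ring

theorem auxG_deriv [Nonempty S] (a : ι → S → ℝ) (ha : ∀ p σ, a p σ ^ 2 = 1) (c : ι → ℝ)
    (J : ι → ℝ) (p : ι) (x : ℝ) :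
    HasDerivAt (fun y => auxG a (fun q => c q * Function.update J p y q) p)
      (c p * (1 - auxG a (fun q => c q * Function.update J p x q) p ^ 2)) x := by
  have hE : ∀ σ, HasDerivAt (fun y => ∑ q, c q * Function.update J p y q * a q σ)
      (c p * a p σ) x := fun σ => by
    have : HasDerivAt (fun y => ∑ q, c q * Function.update J p y q * a q σ)
        (∑ q, if q = p then c q * a q σ else 0) x := by
      refine HasDerivAt.fun_sum fun q _ => ?_
      by_cases hq : q = p
      · subst hq
        simp only [Function.update_self, if_true]
        simpa using ((hasDerivAt_id x).const_mul (c q)).mul_const (a q σ)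
      · simp only [Function.update_of_ne hq, if_neg hq]
        exact hasDerivAt_const _ _
    simpa using this
  set E : S → ℝ := fun σ => Real.exp (∑ q, c q * Function.update J p x q * a q σ) with hEdef
  have hZ : HasDerivAt (fun y => auxZ a (fun q => c q * Function.update J p y q))
      (∑ σ, E σ * (c p * a p σ)) x := HasDerivAt.fun_sum fun σ _ => (hE σ).exp
  have hN : HasDerivAt (fun y => ∑ σ, a p σ *
      Real.exp (∑ q, c q * Function.update J p y q * a q σ))
      (∑ σ, a p σ * (E σ * (c p * a p σ))) x :=
    HasDerivAt.fun_sum fun σ _ => ((hE σ).exp).const_mul _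
  have hZ0 := auxZ_pos a (fun q => c q * Function.update J p x q)
  have key := hN.div hZ hZ0.ne'
  have e1 : ∑ σ, E σ * (c p * a p σ) = c p * ∑ σ, a p σ * E σ := by
    rw [Finset.mul_sum]; exact Finset.sum_congr rfl fun σ _ => by ring
  have e2 : ∑ σ, a p σ * (E σ * (c p * a p σ))
      = c p * auxZ a (fun q => c q * Function.update J p x q) := by
    rw [auxZ, Finset.mul_sum]
    refine Finset.sum_congr rfl fun σ _ => ?_
    have := ha p σ
    simp only [hEdef]
    linear_combination (c p * Real.exp (∑ q, c q * Function.update J p x q * a q σ)) * this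
  rw [e1, e2] at key
  refine HasDerivAt.congr_deriv (f := fun y => auxG a (fun q => c q * Function.update J p y q) p) key ?_
  unfold auxG
  simp only [hEdef]
  field_simp

/-- Abstract form of the derivative formula. -/
theorem aux_main [Nonempty S] (a : ι → S → ℝ) (ha : ∀ p σ, a p σ ^ 2 = 1)
    (c c' : ℝ → ι → ℝ) (u : Set ℝ) (t : ℝ) (hu : u ∈ nhds t) (C : ℝ)
    (hd : ∀ s ∈ u, ∀ p, HasDerivAt (fun s => c s p) (c' s p) s)
    (hb : ∀ s ∈ u, ∀ p, |c' s p| ≤ C) :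
    HasDerivAt (fun s => ∫ J, Real.log (auxZ a (fun q => c s q * J q))
        ∂(Measure.pi fun _ : ι => gaussianReal 0 1))
      (∫ J, ∑ p, c' t p * c t p * (1 - auxG a (fun q => c t q * J q) p ^ 2)
        ∂(Measure.pi fun _ : ι => gaussianReal 0 1)) t := by
  have hcJ : ∀ s, Continuous (fun J : ι → ℝ => fun q => c s q * J q) := fun s => by fun_prop
  have hGc : ∀ s p, Continuous (fun J : ι → ℝ => auxG a (fun q => c s q * J q) p) :=
    fun s p => (auxG_cont a p).comp (hcJ s)
  have hLc : ∀ s, Continuous (fun J : ι → ℝ => Real.log (auxZ a (fun q => c s q * J q))) :=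
    fun s => (auxlogZ_cont a).comp (hcJ s)
  have h1 := hasDerivAt_integral_of_dominated_loc_of_deriv_le
    (μ := Measure.pi fun _ : ι => gaussianReal 0 1)
    (F := fun s J => Real.log (auxZ a (fun q => c s q * J q)))
    (F' := fun s J => ∑ p, c' s p * J p * auxG a (fun q => c s q * J q) p)
    (bound := fun J => ∑ p, C * |J p|) hu
    (Filter.Eventually.of_forall fun s => (hLc s).aestronglyMeasurable)
    (by
      refine Integrable.mono' (g := fun J => Real.log (Fintype.card S) + ∑ p, |c t p * J p|)
        ?_ (hLc t).aestronglyMeasurable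
        (Filter.Eventually.of_forall fun J => auxlogZ_bound a ha _)
      refine (integrable_const _).add (integrable_finsetSum _ fun p _ => ?_)
      exact ((aux_integrable_coord p).const_mul _).abs)
    (by
      refine Continuous.aestronglyMeasurable ?_
      have := hGc t
      fun_prop)
    (Filter.Eventually.of_forall fun J s hs => by
      refine (Finset.abs_sum_le_sum_abs _ _).trans (Finset.sum_le_sum fun p _ => ?_)
      rw [abs_mul, abs_mul]
      have h1 := auxG_abs a ha (fun q => c s q * J q) p
      have h2 := hb s hs p
      calc _ ≤ |c' s p| * |J p| * 1 := by gcongr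
        _ ≤ C * |J p| := by rw [mul_one]; gcongr)
    (integrable_finsetSum _ fun p _ => ((aux_integrable_coord p).abs).const_mul C)
    (Filter.Eventually.of_forall fun J s hs =>
      auxlogZ_deriv a (fun s q => c s q * J q) (fun q => c' s q * J q) s
        fun p => (hd s hs p).mul_const _)
  have h2 := h1.2
  refine h2.congr_deriv ?_
  symm
  have hb1 : ∀ (J : ι → ℝ) p, |1 - auxG a (fun q => c t q * J q) p ^ 2| ≤ 1 := fun J p => by
    have := auxG_abs a ha (fun q => c t q * J q) p
    have h3 : auxG a (fun q => c t q * J q) p ^ 2 ≤ 1 := (sq_le_one_iff_abs_le_one _).2 this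
    rw [abs_le]; constructor <;> nlinarith [sq_nonneg (auxG a (fun q => c t q * J q) p)]
  rw [integral_finsetSum, integral_finsetSum]
  · refine Finset.sum_congr rfl fun p _ => ?_
    have hs := aux_stein p (fun J => auxG a (fun q => c t q * J q) p)
      (fun J => c t p * (1 - auxG a (fun q => c t q * J q) p ^ 2)) (1 + |c t p|)
      (fun J x => auxG_deriv a ha (c t) J p x)
      (fun J => (auxG_abs a ha _ p).trans (by linarith [abs_nonneg (c t p)]))
      (fun J => by
        rw [abs_mul]
        have := mul_le_mul_of_nonneg_left (hb1 J p) (abs_nonneg (c t p))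
        linarith)
      (hGc t p).measurable
      (by have := (hGc t p); exact Continuous.measurable (by fun_prop))
    calc _ = c' t p * ∫ J, c t p * (1 - auxG a (fun q => c t q * J q) p ^ 2)
              ∂(Measure.pi fun _ : ι => gaussianReal 0 1) := by
            rw [← integral_const_mul]; congr 1; ext J; ring
      _ = _ := by rw [← hs, ← integral_const_mul]; congr 1; ext J; ring
  · intro p _
    have h3 : Integrable (fun J : ι → ℝ => J p * auxG a (fun q => c t q * J q) p)
        (Measure.pi fun _ : ι => gaussianReal 0 1) :=
      (aux_integrable_coord p).mul_bdd (c := 1) (hGc t p).aestronglyMeasurable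
        (Filter.Eventually.of_forall fun J => auxG_abs a ha _ p)
    simpa only [mul_assoc] using h3.const_mul (c' t p)
  · intro p _
    refine Integrable.const_mul ?_ _
    refine Integrable.of_bound (C := 1) ?_ (Filter.Eventually.of_forall fun J => hb1 J p)
    have := hGc t p
    exact Continuous.aestronglyMeasurable (by fun_prop)

end Helpers

/-- Concrete weights, as a function of the interpolation parameter. -/
noncomputable def auxc {N M : ℕ} (xg : Fin N → Fin N → ℝ) (xb : ℝ) (blk : Fin N → Fin M) (s : ℝ) :
    (Fin N × Fin N) ⊕ (Fin N × Fin N) → ℝ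
  | .inl p => √s * √(xg p.1 p.2)
  | .inr p => √(1 - s) * (if blk p.1 = blk p.2 then √xb else 0)

/-- Derivative of the concrete weights. -/
noncomputable def auxc' {N M : ℕ} (xg : Fin N → Fin N → ℝ) (xb : ℝ) (blk : Fin N → Fin M) (s : ℝ) :
    (Fin N × Fin N) ⊕ (Fin N × Fin N) → ℝ
  | .inl p => 1 / (2 * √s) * √(xg p.1 p.2)
  | .inr p => -1 / (2 * √(1 - s)) * (if blk p.1 = blk p.2 then √xb else 0)

/-- Concrete two-spin observables. -/
noncomputable def auxa {N : ℕ} : (Fin N × Fin N) ⊕ (Fin N × Fin N) → (Fin N → Bool) → ℝ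
  | .inl p, σ => spin σ p.1 * spin σ p.2
  | .inr p, σ => spin σ p.1 * spin σ p.2

theorem aux_spin_sq {N : ℕ} (σ : Fin N → Bool) (i : Fin N) : spin σ i ^ 2 = 1 := by
  unfold spin; split_ifs <;> norm_num

theorem auxa_sq {N : ℕ} (p : (Fin N × Fin N) ⊕ (Fin N × Fin N)) (σ : Fin N → Bool) :
    auxa p σ ^ 2 = 1 := by
  rcases p with p | p <;> simp [auxa, mul_pow, aux_spin_sq]

theorem aux_H {N M : ℕ} (xg : Fin N → Fin N → ℝ) (xb : ℝ) (blk : Fin N → Fin M)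
    (hg : ∀ i j, 0 ≤ xg i j) (hb : 0 ≤ xb) (s : ℝ)
    (J : (Fin N × Fin N) ⊕ (Fin N × Fin N) → ℝ) (σ : Fin N → Bool) :
    symInterpH xg xb blk s
      (MeasurableEquiv.sumPiEquivProdPi (fun _ : (Fin N × Fin N) ⊕ (Fin N × Fin N) => ℝ) J) σ
      = ∑ p, auxc xg xb blk s p * J p * auxa p σ := by
  rw [Fintype.sum_sum_type, ← Finset.sum_add_distrib]
  unfold symInterpH
  refine Finset.sum_congr rfl fun p _ => ?_
  simp only [auxc, auxa, MeasurableEquiv.coe_sumPiEquivProdPi, Equiv.sumPiEquivProdPi,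
    Equiv.coe_fn_mk]
  rw [Real.sqrt_mul' _ (hg _ _), Real.sqrt_mul' _ hb]
  split_ifs <;> ring

theorem aux_concrete {N M : ℕ} (xg : Fin N → Fin N → ℝ) (xb : ℝ) (blk : Fin N → Fin M)
    (hg : ∀ i j, 0 ≤ xg i j) (hb : 0 ≤ xb) (t : ℝ) (ht : t ∈ Set.Ioo (0 : ℝ) 1) :
    HasDerivAt (fun s => ∫ J,
        Real.log (∑ σ : Fin N → Bool, Real.exp (symInterpH xg xb blk s J σ)) ∂(disorderMeasure N))
      ((1 / 2) * ∫ J,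
        ((∑ p : Fin N × Fin N, xg p.1 p.2 * (1 - (symInterpGibbs xg xb blk t J p.1 p.2) ^ 2))
          - ∑ p ∈ Finset.univ.filter (fun p : Fin N × Fin N => blk p.1 = blk p.2),
              xb * (1 - (symInterpGibbs xg xb blk t J p.1 p.2) ^ 2))
        ∂(disorderMeasure N)) t := by
  obtain ⟨ht0, ht1⟩ := ht
  have hmp := measurePreserving_sumPiEquivProdPi
    (fun _ : (Fin N × Fin N) ⊕ (Fin N × Fin N) => gaussianReal 0 1)
  have hint : ∀ f : (Fin N × Fin N → ℝ) × (Fin N × Fin N → ℝ) → ℝ,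
      ∫ J, f J ∂(disorderMeasure N) = ∫ J, f (MeasurableEquiv.sumPiEquivProdPi
        (fun _ : (Fin N × Fin N) ⊕ (Fin N × Fin N) => ℝ) J)
        ∂(Measure.pi fun _ : (Fin N × Fin N) ⊕ (Fin N × Fin N) => gaussianReal 0 1) := fun f =>
    (hmp.integral_comp' (g := f)).symm
  have hG : ∀ J (p : Fin N × Fin N), symInterpGibbs xg xb blk t (MeasurableEquiv.sumPiEquivProdPi
        (fun _ : (Fin N × Fin N) ⊕ (Fin N × Fin N) => ℝ) J) p.1 p.2
      = auxG auxa (fun q => auxc xg xb blk t q * J q) (.inl p) := fun J p => by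
    simp only [symInterpGibbs, aux_H xg xb blk hg hb, auxG, auxZ]
    rfl
  have hG2 : ∀ (J : (Fin N × Fin N) ⊕ (Fin N × Fin N) → ℝ) (p : Fin N × Fin N),
      auxG auxa (fun q => auxc xg xb blk t q * J q) (.inr p)
      = auxG auxa (fun q => auxc xg xb blk t q * J q) (.inl p) := fun J p => rfl
  have hdl : ∀ s, 0 < s → HasDerivAt (fun s : ℝ => √s) (1 / (2 * √s)) s := fun s hs =>
    Real.hasDerivAt_sqrt hs.ne'
  have hdr : ∀ s, s < 1 → HasDerivAt (fun s : ℝ => √(1 - s)) (-1 / (2 * √(1 - s))) s :=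
    fun s hs => ((hasDerivAt_id s).const_sub 1).sqrt (by simp only [id]; linarith)
  set W : ℝ := (∑ p : Fin N × Fin N, √(xg p.1 p.2)) + √xb with hW
  have hW0 : 0 ≤ ∑ p : Fin N × Fin N, √(xg p.1 p.2) :=
    Finset.sum_nonneg fun _ _ => Real.sqrt_nonneg _
  have hWl : ∀ p : Fin N × Fin N, √(xg p.1 p.2) ≤ W := fun p => by
    have := Finset.single_le_sum (f := fun p : Fin N × Fin N => √(xg p.1 p.2))
      (fun _ _ => Real.sqrt_nonneg _) (Finset.mem_univ p)
    have h2 := Real.sqrt_nonneg xb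
    linarith
  have hWr : ∀ p : Fin N × Fin N, (if blk p.1 = blk p.2 then √xb else 0) ≤ W := fun p => by
    have h2 := Real.sqrt_nonneg xb
    split_ifs <;> linarith
  have hWp : 0 ≤ W := by positivity
  have hmain := aux_main (auxa (N := N)) auxa_sq (auxc xg xb blk) (auxc' xg xb blk)
    (Set.Ioo (t / 2) ((1 + t) / 2)) t (Ioo_mem_nhds (by linarith) (by linarith))
    ((1 / (2 * √(t / 2)) + 1 / (2 * √((1 - t) / 2))) * W)
    (by
      rintro s ⟨hs1, hs2⟩ (p | p)
      · exact (hdl s (by linarith)).mul_const _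
      · exact (hdr s (by linarith)).mul_const _)
    (by
      have q1 : 0 < √(t / 2) := Real.sqrt_pos.2 (by linarith)
      have q2 : 0 < √((1 - t) / 2) := Real.sqrt_pos.2 (by linarith)
      rintro s ⟨hs1, hs2⟩ (p | p)
      · simp only [auxc']
        rw [abs_of_nonneg (by positivity)]
        have h1 : 1 / (2 * √s) ≤ 1 / (2 * √(t / 2)) := by gcongr
        have h2 : 0 ≤ 1 / (2 * √((1 - t) / 2)) := by positivity
        exact mul_le_mul (by linarith) (hWl p) (Real.sqrt_nonneg _) (by positivity)
      · simp only [auxc']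
        have h0 : 0 ≤ (if blk p.1 = blk p.2 then √xb else 0) := by split_ifs <;> positivity
        rw [abs_mul, abs_of_nonneg h0, neg_div, abs_neg, abs_of_nonneg (by positivity)]
        have h1 : 1 / (2 * √(1 - s)) ≤ 1 / (2 * √((1 - t) / 2)) := by
          gcongr; linarith
        have h2 : 0 ≤ 1 / (2 * √(t / 2)) := by positivity
        exact mul_le_mul (by linarith) (hWr p) h0 (by positivity))
  have hfun : (fun s => ∫ J, Real.log (∑ σ : Fin N → Bool, Real.exp (symInterpH xg xb blk s J σ))
        ∂(disorderMeasure N)) = fun s => ∫ J, Real.log (auxZ auxa (fun q => auxc xg xb blk s q * J q))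
        ∂(Measure.pi fun _ : (Fin N × Fin N) ⊕ (Fin N × Fin N) => gaussianReal 0 1) := by
    ext s
    rw [hint]
    simp only [aux_H xg xb blk hg hb, auxZ]
  rw [hfun]
  refine hmain.congr_deriv ?_
  symm
  · rw [hint, ← integral_const_mul]
    congr 1
    ext J
    rw [Fintype.sum_sum_type, Finset.sum_filter, mul_sub, Finset.mul_sum, Finset.mul_sum,
      sub_eq_add_neg, ← Finset.sum_neg_distrib]
    have q1 : 0 < √t := Real.sqrt_pos.2 (by linarith)
    have q2 : 0 < √(1 - t) := Real.sqrt_pos.2 (by linarith)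
    congr 1
    · refine Finset.sum_congr rfl fun p _ => ?_
      rw [hG]
      have e : auxc' xg xb blk t (.inl p) * auxc xg xb blk t (.inl p) = 1 / 2 * xg p.1 p.2 := by
        simp only [auxc, auxc']
        have := Real.mul_self_sqrt (hg p.1 p.2)
        field_simp
        nlinarith
      rw [e]; ring
    · refine Finset.sum_congr rfl fun p _ => ?_
      rw [hG, hG2]
      have e : auxc' xg xb blk t (.inr p) * auxc xg xb blk t (.inr p)
          = if blk p.1 = blk p.2 then - (1 / 2 * xb) else 0 := by
        simp only [auxc, auxc']
        have := Real.mul_self_sqrt hb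
        split_ifs
        · field_simp
          nlinarith
        · simp
      rw [e]
      split_ifs <;> ring

/-- derivative of the symmetric-distribution interpolating pressure `B_L(t)`:
`d/dt (1/L^d) B_L(t) = (1/(2L^d)) E[ Σ_{i,j∈Λ} x^γ_{ij} (1 - ⟨σ_iσ_j⟩²)
  - Σ_p Σ_{i,j∈B_p} x_{ij} (1 - ⟨σ_iσ_j⟩²) ]`,
with `x^γ_{ij} = β² K(r_ij,γ)/2` and `x_{ij} = β²/(2 l^d)`. -/
theorem deriv_interpolating_pressure_symmetric (L d l M : ℕ) (hL : 0 < L) (hl : 0 < l)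
    (β : ℝ) (Kv : Fin (L ^ d) → Fin (L ^ d) → ℝ) (hK : ∀ i j, 0 ≤ Kv i j)
    (blk : Fin (L ^ d) → Fin M) (t : ℝ) (ht : t ∈ Set.Ioo (0 : ℝ) 1) :
    HasDerivAt (fun s => (1 / ((L : ℝ) ^ d)) * ∫ J,
        Real.log (∑ σ : Fin (L ^ d) → Bool,
          Real.exp (symInterpH (fun i j => β ^ 2 * Kv i j / 2)
            (β ^ 2 / (2 * (l : ℝ) ^ d)) blk s J σ)) ∂(disorderMeasure (L ^ d)))
      ((1 / (2 * (L : ℝ) ^ d)) * ∫ J,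
        ((∑ p : Fin (L ^ d) × Fin (L ^ d), (β ^ 2 * Kv p.1 p.2 / 2) *
            (1 - (symInterpGibbs (fun i j => β ^ 2 * Kv i j / 2)
              (β ^ 2 / (2 * (l : ℝ) ^ d)) blk t J p.1 p.2) ^ 2))
          - ∑ p ∈ Finset.univ.filter
              (fun p : Fin (L ^ d) × Fin (L ^ d) => blk p.1 = blk p.2),
              (β ^ 2 / (2 * (l : ℝ) ^ d)) *
                (1 - (symInterpGibbs (fun i j => β ^ 2 * Kv i j / 2)
                  (β ^ 2 / (2 * (l : ℝ) ^ d)) blk t J p.1 p.2) ^ 2))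
        ∂(disorderMeasure (L ^ d))) t := by
  have h := (aux_concrete (fun i j => β ^ 2 * Kv i j / 2) (β ^ 2 / (2 * (l : ℝ) ^ d)) blk
    (fun i j => by have := hK i j; positivity) (by positivity) t ht).const_mul (1 / (L : ℝ) ^ d)
  refine h.congr_deriv ?_
  symm
  rw [← mul_assoc]
  congr 1
  rw [div_mul_div_comm, one_mul, mul_comm]
end
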